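/- Let F : ℝⁿ → ℝᵐ be continuously differentiable, ψ(x,d) = max_{1≤i≤m} ⟨∇Fᵢ(x), d⟩, and v(x) the unique minimizer over d of ψ(x,d) + ½‖d‖². Let (xₖ) be a sequence of non-Pareto-critical points, γₖ > 0, Nₖ = min{k, N} for a fixed N ∈ ℤ₊, and define d₀ = γ₀ v(x₀) and, for k ≥ 1, dₖ = γₖ v(xₖ) + Σ_{j=1}^{Nₖ} β_{kj} d_{k−j}, where β_{kj} = −(1/Nₖ) ψ(xₖ, v(xₖ)) / φ_{kj} with parameters φ_{kj} > max{ψ(xₖ, d_{k−j})/γₖ, 0}. Then dₖ is a descent direction for F at xₖ for all k, i.e. ψ(xₖ, dₖ) < 0. -/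

import Mathlib

open scoped RealInnerProductSpace

noncomputable def psi {n m : ℕ} [NeZero m]
    (F : Fin m → EuclideanSpace ℝ (Fin n) → ℝ)
    (x d : EuclideanSpace ℝ (Fin n)) : ℝ :=
  Finset.univ.sup' Finset.univ_nonempty fun i => ⟪gradient (F i) x, d⟫

theorem inner_gradient_le_psi {n m : ℕ} [NeZero m]
    (F : Fin m → EuclideanSpace ℝ (Fin n) → ℝ) (x d : EuclideanSpace ℝ (Fin n)) (i : Fin m) :
    ⟪gradient (F i) x, d⟫ ≤ psi F x d :=
  Finset.le_sup' (fun i => ⟪gradient (F i) x, d⟫) (Finset.mem_univ i)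

theorem psi_lt_iff {n m : ℕ} [NeZero m]
    (F : Fin m → EuclideanSpace ℝ (Fin n) → ℝ) (x d : EuclideanSpace ℝ (Fin n)) (a : ℝ) :
    psi F x d < a ↔ ∀ i, ⟪gradient (F i) x, d⟫ < a := by
  simp [psi, Finset.sup'_lt_iff]

theorem psi_smul_le {n m : ℕ} [NeZero m]
    (F : Fin m → EuclideanSpace ℝ (Fin n) → ℝ) (x d : EuclideanSpace ℝ (Fin n))
    {t : ℝ} (ht : 0 ≤ t) : psi F x (t • d) ≤ t * psi F x d := by
  refine Finset.sup'_le _ _ fun i _ => ?_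
  rw [real_inner_smul_right]
  exact mul_le_mul_of_nonneg_left (inner_gradient_le_psi F x d i) ht

/-- At a point admitting a descent direction, the steepest descent direction is one. -/
theorem psi_steepest_descent_neg {n m : ℕ} [NeZero m]
    (F : Fin m → EuclideanSpace ℝ (Fin n) → ℝ) {x w : EuclideanSpace ℝ (Fin n)}
    (hw : ∀ d, psi F x w + ‖w‖ ^ 2 / 2 ≤ psi F x d + ‖d‖ ^ 2 / 2)
    (hx : ∃ d, psi F x d < 0) : psi F x w < 0 := by
  obtain ⟨d, hd⟩ := hx
  set a := psi F x d
  have hb : 0 < ‖d‖ ^ 2 + 1 := by positivity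
  set t := -a / (‖d‖ ^ 2 + 1)
  have htpos : 0 < t := div_pos (neg_pos.mpr hd) hb
  have hta : t * (‖d‖ ^ 2 + 1) = -a := div_mul_cancel₀ _ hb.ne'
  have hmin := hw (t • d)
  have hsmul := psi_smul_le F x d htpos.le
  rw [norm_smul, Real.norm_of_nonneg htpos.le, mul_pow] at hmin
  have hat : t * a = -(t ^ 2 * ‖d‖ ^ 2) - t ^ 2 := by
    rw [← neg_neg a, ← hta]; ring
  have h₁ : 0 < t ^ 2 := by positivity
  have h₂ : 0 ≤ t ^ 2 * ‖d‖ ^ 2 := by positivity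
  have h₃ : 0 ≤ ‖w‖ ^ 2 := by positivity
  linarith

theorem stmt18 {n m : ℕ} [NeZero m]
    (F : Fin m → EuclideanSpace ℝ (Fin n) → ℝ)
    (hF : ∀ i, ContDiff ℝ 1 (F i))
    (v : EuclideanSpace ℝ (Fin n) → EuclideanSpace ℝ (Fin n))
    (hv : ∀ x d, psi F x (v x) + ‖v x‖ ^ 2 / 2 ≤ psi F x d + ‖d‖ ^ 2 / 2)
    (x : ℕ → EuclideanSpace ℝ (Fin n))
    (hncrit : ∀ k, ∃ dd, psi F (x k) dd < 0)
    (γ : ℕ → ℝ) (hγ : ∀ k, 0 < γ k)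
    (N : ℕ) (hN : 0 < N)
    (β φ : ℕ → ℕ → ℝ)
    (d : ℕ → EuclideanSpace ℝ (Fin n))
    (hd0 : d 0 = γ 0 • v (x 0))
    (hdk : ∀ k, 1 ≤ k → d k = γ k • v (x k) +
      ∑ j ∈ Finset.Icc 1 (min k N), β k j • d (k - j))
    (hβ : ∀ k, 1 ≤ k → ∀ j ∈ Finset.Icc 1 (min k N),
      β k j = -(1 / (min k N : ℝ)) * psi F (x k) (v (x k)) / φ k j)
    (hφ : ∀ k, 1 ≤ k → ∀ j ∈ Finset.Icc 1 (min k N),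
      φ k j > max (psi F (x k) (d (k - j)) / γ k) 0) :
    ∀ k, psi F (x k) (d k) < 0 := by
  intro k
  have hneg : psi F (x k) (v (x k)) < 0 := psi_steepest_descent_neg F (hv (x k)) (hncrit k)
  rw [psi_lt_iff]
  intro i
  have hγv : γ k * ⟪gradient (F i) (x k), v (x k)⟫ ≤ γ k * psi F (x k) (v (x k)) :=
    mul_le_mul_of_nonneg_left (inner_gradient_le_psi F _ _ i) (hγ k).le
  rcases Nat.eq_zero_or_pos k with rfl | hk
  · rw [hd0, real_inner_smul_right]
    exact hγv.trans_lt (mul_neg_of_pos_of_neg (hγ 0) hneg)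
  · have hM : 0 < min k N := lt_min hk hN
    have hM' : (0 : ℝ) < min (k : ℝ) N := by exact_mod_cast hM
    have hterm : ∀ j ∈ Finset.Icc 1 (min k N),
        β k j * ⟪gradient (F i) (x k), d (k - j)⟫ <
          -(γ k * psi F (x k) (v (x k))) / min (k : ℝ) N := by
      intro j hj
      obtain ⟨hψφ, hφpos⟩ := max_lt_iff.mp (hφ k hk j hj)
      have hle := inner_gradient_le_psi F (x k) (d (k - j)) i
      have hlt : ⟪gradient (F i) (x k), d (k - j)⟫ < φ k j * γ k :=
        hle.trans_lt ((div_lt_iff₀ (hγ k)).mp hψφ)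
      have hβpos : 0 < β k j := by
        rw [hβ k hk j hj]
        exact div_pos (mul_pos_of_neg_of_neg (neg_neg_of_pos (by positivity)) hneg) hφpos
      calc β k j * ⟪gradient (F i) (x k), d (k - j)⟫ < β k j * (φ k j * γ k) :=
            mul_lt_mul_of_pos_left hlt hβpos
        _ = -(γ k * psi F (x k) (v (x k))) / min (k : ℝ) N := by
            rw [hβ k hk j hj]
            field_simp
    have hsum := Finset.sum_lt_sum_of_nonempty
      (Finset.nonempty_Icc.mpr (Nat.one_le_iff_ne_zero.mpr hM.ne')) hterm
    rw [Finset.sum_const, Nat.card_Icc, Nat.add_sub_cancel, nsmul_eq_mul, Nat.cast_min,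
      mul_div_cancel₀ _ hM'.ne'] at hsum
    rw [hdk k hk, inner_add_right, inner_sum, real_inner_smul_right]
    simp only [real_inner_smul_right]
    linarith
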